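/- Suppose T is a uniform binary AND-OR tree and 0 < r < 1. If d is an independent distribution on the leaf assignments of T in which the root has probability r of value 0, and d maximizes min over deterministic alpha-beta algorithms of expected cost among all such independent distributions with root probability r, then d is an independent identical distribution (all leaves have the same probability of being 0). -/

import Mathlib

/-- Value of the uniform binary tree of height `n` with alternating gates and root gate `g`
(`true` = AND, `false` = OR), under leaf assignment `f`. Leaves are indexed by root-to-leaf
paths `Fin n → Bool`; `true` = value 1, `false` = value 0. -/
def aoval : (n : ℕ) → Bool → ((Fin n → Bool) → Bool) → Bool
  | 0, _, f => f (fun i => i.elim0)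
  | n + 1, g, f =>
      let l := aoval n (!g) (fun v => f (Fin.cons false v))
      let r := aoval n (!g) (fun v => f (Fin.cons true v))
      if g then l && r else l || r

/-- Deterministic (adaptive) leaf-querying algorithms, as decision trees:
`query q t0 t1` probes leaf `q` and continues with `t0` if it has value 0, `t1` if value 1. -/
inductive DTree (n : ℕ) : Type
  | ans (b : Bool) : DTree n
  | query (q : Fin n → Bool) (t0 t1 : DTree n) : DTree n

/-- Output of a decision tree on an assignment. -/
def DTree.run {n : ℕ} : DTree n → ((Fin n → Bool) → Bool) → Bool
  | .ans b, _ => b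
  | .query q t0 t1, f => if f q then t1.run f else t0.run f

/-- Number of leaves probed by a decision tree on an assignment. -/
def DTree.cost {n : ℕ} : DTree n → ((Fin n → Bool) → Bool) → ℕ
  | .ans _, _ => 0
  | .query q t0 t1, f => 1 + (if f q then t1.cost f else t0.cost f)

/-- A deterministic alpha-beta algorithm must compute the root value on every assignment. -/
def DTree.correct {n : ℕ} (t : DTree n) (g : Bool) : Prop :=
  ∀ f, t.run f = aoval n g f

/-- Probability of leaf assignment `f` under the independent distribution in which leaf `q`
has value 0 with probability `σ q`. -/
noncomputable def wt {n : ℕ} (σ : (Fin n → Bool) → ℝ) (f : (Fin n → Bool) → Bool) : ℝ :=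
  ∏ q : Fin n → Bool, (if f q then 1 - σ q else σ q)

/-- Expected number of leaves probed by the algorithm `t` under the independent
distribution `σ`. -/
noncomputable def eCost {n : ℕ} (t : DTree n) (σ : (Fin n → Bool) → ℝ) : ℝ :=
  ∑ f : (Fin n → Bool) → Bool, wt σ f * (t.cost f : ℝ)

/-- Probability that the root (gate `g`) has value 0 under the independent distribution `σ`. -/
noncomputable def rootProb {n : ℕ} (g : Bool) (σ : (Fin n → Bool) → ℝ) : ℝ :=
  ∑ f : (Fin n → Bool) → Bool, (if aoval n g f = false then wt σ f else 0)

/-- `σ` is an independent distribution: each leaf probability lies in `[0,1]`. -/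
def validID {n : ℕ} (σ : (Fin n → Bool) → ℝ) : Prop := ∀ q, 0 ≤ σ q ∧ σ q ≤ 1

/-- Minimum, over deterministic alpha-beta algorithms, of the expected cost under `σ`. -/
noncomputable def minCost {n : ℕ} (g : Bool) (σ : (Fin n → Bool) → ℝ) : ℝ :=
  sInf {c : ℝ | ∃ t : DTree n, t.correct g ∧ c = eCost t σ}

namespace AOT
open Function

inductive T (α : Type) : Type
  | ans (b : Bool) : T α
  | query (q : α) (k : Bool → T α) : T α

def T.run {α : Type} : T α → (α → Bool) → Bool
  | .ans b, _ => b
  | .query q k, f => (k (f q)).run f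

def dl (v : Bool) : Bool → ℝ := fun u => if u = v then 1 else 0

noncomputable def ec {α : Type} [DecidableEq α] : T α → (α → Bool → ℝ) → (α → ℝ) → ℝ
  | .ans _, _, _ => 0
  | .query q k, P, w => w q
      + P q true * ec (k true) (update P q (dl true)) (update w q 0)
      + P q false * ec (k false) (update P q (dl false)) (update w q 0)

def subst {α β : Type} (θ : α → β ⊕ Bool) : T α → T β
  | .ans b => .ans b
  | .query q k => match θ q with
    | .inl q' => .query q' (fun v => subst θ (k v))
    | .inr v => subst θ (k v)

def pullF {α β : Type} (θ : α → β ⊕ Bool) (f : β → Bool) (q : α) : Bool :=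
  match θ q with
  | .inl q' => f q'
  | .inr v => v

noncomputable def pullP {α β : Type} (θ : α → β ⊕ Bool) (P : β → Bool → ℝ) (q : α) : Bool → ℝ :=
  match θ q with
  | .inl q' => P q'
  | .inr v => dl v

noncomputable def pullW {α β : Type} (θ : α → β ⊕ Bool) (w : β → ℝ) (q : α) : ℝ :=
  match θ q with
  | .inl q' => w q'
  | .inr _ => 0

theorem subst_run {α β : Type} (θ : α → β ⊕ Bool) (f : β → Bool) (t : T α) :
    (subst θ t).run f = t.run (pullF θ f) := by
  induction t with
  | ans b => rfl
  | query q k ih =>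
    rcases h : θ q with q' | v
    · have : pullF θ f q = f q' := by simp [pullF, h]
      simp [subst, h, T.run, ih, this]
    · have : pullF θ f q = v := by simp [pullF, h]
      simp [subst, h, T.run, ih, this]

theorem subst_ec {α β : Type} [DecidableEq α] [DecidableEq β] (θ : α → β ⊕ Bool)
    (hθ : ∀ q1 q2 r, θ q1 = .inl r → θ q2 = .inl r → q1 = q2) (t : T α) :
    ∀ (P : β → Bool → ℝ) (w : β → ℝ),
    ec (subst θ t) P w = ec t (pullP θ P) (pullW θ w) := by
  induction t with
  | ans b => intros; rfl
  | query q k ih =>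
    intro P w
    rcases h : θ q with q' | v
    · have h1 : pullP θ P q = P q' := by simp [pullP, h]
      have h2 : pullW θ w q = w q' := by simp [pullW, h]
      have h3 : ∀ s, pullP θ (update P q' s) = update (pullP θ P) q s := by
        intro s
        funext r
        by_cases hr : r = q
        · subst hr; simp [pullP, h]
        · rcases h' : θ r with r' | v
          · have : r' ≠ q' := fun e => hr (hθ r q q' (e ▸ h') h)
            simp [pullP, h', hr, this]
          · simp [pullP, h', hr]
      have h4 : ∀ s, pullW θ (update w q' s) = update (pullW θ w) q s := by
        intro s
        funext r
        by_cases hr : r = q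
        · subst hr; simp [pullW, h]
        · rcases h' : θ r with r' | v
          · have : r' ≠ q' := fun e => hr (hθ r q q' (e ▸ h') h)
            simp [pullW, h', hr, this]
          · simp [pullW, h', hr]
      simp [subst, h, ec, ih, h1, h2, h3, h4]
    · have h1 : pullP θ P q = dl v := by simp [pullP, h]
      have h2 : pullW θ w q = 0 := by simp [pullW, h]
      have h3 : update (pullP θ P) q (dl v) = pullP θ P := by rw [← h1]; simp
      have h4 : update (pullW θ w) q 0 = pullW θ w := by rw [← h2]; simp
      simp only [subst, h, ec, ih, h1, h2, h4]
      cases v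
      · have a1 : dl false true = 0 := by simp [dl]
        have a2 : dl false false = 1 := by simp [dl]
        rw [a1, a2, h3]; ring
      · have a1 : dl true true = 1 := by simp [dl]
        have a2 : dl true false = 0 := by simp [dl]
        rw [a1, a2, h3]; ring

def Nn {α : Type} (P : α → Bool → ℝ) : Prop := ∀ q v, 0 ≤ P q v

theorem dl_nn (v u : Bool) : 0 ≤ dl v u := by unfold dl; split <;> norm_num

theorem Nn.upd {α : Type} [DecidableEq α] {P : α → Bool → ℝ} (h : Nn P) (q : α) (v : Bool) :
    Nn (update P q (dl v)) := by
  intro r u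
  by_cases hr : r = q
  · subst hr; simpa using dl_nn v u
  · simpa [hr] using h r u

theorem ec_nonneg {α : Type} [DecidableEq α] (t : T α) :
    ∀ (P : α → Bool → ℝ) (w : α → ℝ), Nn P → (∀ q, 0 ≤ w q) → 0 ≤ ec t P w := by
  induction t with
  | ans b => intros; exact le_rfl
  | query q k ih =>
    intro P w hP hw
    have hw' : ∀ r, 0 ≤ update w q 0 r := by
      intro r
      by_cases hr : r = q
      · subst hr; simp
      · simpa [hr] using hw r
    have h1 := mul_nonneg (hP q true) (ih true _ _ (hP.upd q true) hw')
    have h2 := mul_nonneg (hP q false) (ih false _ _ (hP.upd q false) hw')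
    have := hw q
    simp only [ec]
    linarith

theorem ec_lin {α : Type} [DecidableEq α] (b : α) (t : T α) :
    ∀ (P : α → Bool → ℝ) (w : α → ℝ), Nn P → ∃ β : ℝ, 0 ≤ β ∧ ∀ (s : Bool → ℝ) (c : ℝ),
      s true + s false = 1 →
      ec t (update P b s) (update w b c) =
        s true * ec t (update P b (dl true)) (update w b 0)
        + s false * ec t (update P b (dl false)) (update w b 0) + c * β := by
  induction t with
  | ans b => intros; exact ⟨0, le_rfl, by intros; simp [ec]⟩
  | query q k ih =>
    intro P w hP
    by_cases hq : q = b
    · subst hq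
      refine ⟨1, by norm_num, ?_⟩
      intro s c hs
      simp [ec, dl]
      ring
    · obtain ⟨β1, hβ1, h1⟩ := ih true (update P q (dl true)) (update w q 0) (hP.upd q true)
      obtain ⟨β0, hβ0, h0⟩ := ih false (update P q (dl false)) (update w q 0) (hP.upd q false)
      refine ⟨P q true * β1 + P q false * β0,
        add_nonneg (mul_nonneg (hP _ _) hβ1) (mul_nonneg (hP _ _) hβ0), ?_⟩
      intro s c hs
      have e1 := h1 s c hs
      have e0 := h0 s c hs
      simp only [ec, update_of_ne hq]
      have c1 : ∀ (s s' : Bool → ℝ), update (update P b s) q s' = update (update P q s') b s :=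
        fun s s' => update_comm (Ne.symm hq) s s' P
      have c2 : ∀ (s s' : ℝ), update (update w b s) q s' = update (update w q s') b s :=
        fun s s' => update_comm (Ne.symm hq) s s' w
      simp only [c1, c2]
      rw [e1, e0]
      linear_combination (-(w q)) * hs

def gate (d x y : Bool) : Bool := if d then x && y else x || y

theorem merge_core {α : Type} [DecidableEq α] (e e' a : α) (hee : e ≠ e') (ha : a = e ∨ a = e')
    (d : Bool) (x c : ℝ) (hx0 : 0 ≤ x) (hx1 : x ≤ 1) (hc : 0 ≤ c) (k : Bool → T α)
    (P P' : α → Bool → ℝ) (w w' : α → ℝ) (hP : Nn P)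
    (h1 : P e d = x) (h2 : P e (!d) = 1 - x) (h3 : P e' d = x) (h4 : P e' (!d) = 1 - x)
    (h5 : w e = c) (h6 : w e' = c)
    (g1 : P' a d = x ^ 2) (g2 : P' a (!d) = 1 - x ^ 2) (g3 : w' a = c * (1 + x))
    (g4 : ∀ q, q ≠ e → q ≠ e' → P' q = P q) (g5 : ∀ q, q ≠ e → q ≠ e' → w' q = w q) :
    ∃ t' : T α, ec t' P' w' ≤ ec (.query e k) P w ∧
      ∀ f' : α → Bool, ∃ f : α → Bool, t'.run f' = (T.query e k).run f ∧
        gate d (f e) (f e') = f' a ∧ ∀ q, q ≠ e → q ≠ e' → f q = f' q := by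
  set Pe : Bool → α → Bool → ℝ := fun v => update P e (dl v) with hPe
  set we : α → ℝ := update w e 0 with hwe
  have hPee : ∀ v, Pe v e' = P e' := fun v => by simp [hPe, hee.symm]
  have hcost : ec (.query e k) P w = c + (1 - x) * ec (k (!d)) (Pe (!d)) we
      + x * ec (k d) (Pe d) we := by
    cases d <;> simp at h1 h2 <;> simp [ec, h1, h2, h5, hPe, hwe] <;> ring
  -- linear decompositions at e'
  set A : Bool → Bool → ℝ := fun u v => ec (k u) (update (Pe u) e' (dl v)) (update we e' 0) with hA
  have hlin : ∀ u, ∃ β : ℝ, 0 ≤ β ∧ ∀ (s : Bool → ℝ) (c' : ℝ), s d + s (!d) = 1 →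
      ec (k u) (update (Pe u) e' s) (update we e' c') = s d * A u d + s (!d) * A u (!d) + c' * β := by
    intro u
    obtain ⟨β, hβ, h⟩ := ec_lin e' (k u) (Pe u) we (hP.upd e u)
    refine ⟨β, hβ, fun s c' hs => ?_⟩
    cases d
    · simp only [Bool.not_false] at hs ⊢
      rw [h s c' (by linarith)]; ring
    · simp only [Bool.not_true] at hs ⊢
      rw [h s c' (by linarith)]
  have hself : ∀ u, update (Pe u) e' (P e') = Pe u := fun u => by rw [← hPee u]; simp
  have hwself : update we e' c = we := by
    have : we e' = c := by simp [hwe, hee.symm, h6]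
    rw [← this]; simp
  obtain ⟨β0, hβ0, l0⟩ := hlin (!d)
  obtain ⟨β1, hβ1, l1⟩ := hlin d
  have T0 := l0 (P e') c (by rw [h3, h4]; ring)
  have T1 := l1 (P e') c (by rw [h3, h4]; ring)
  rw [hself, hwself, h3, h4] at T0 T1
  -- choose v
  have hv : ∃ v, A (!d) v ≤ ec (k (!d)) (Pe (!d)) we := by
    by_contra! hcon
    have a1 := hcon d
    have a2 := hcon (!d)
    have := mul_nonneg hc hβ0
    rcases hx0.eq_or_lt with h0 | h0
    · rw [← h0] at T0; linarith
    · have b1 := mul_lt_mul_of_pos_left a1 h0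
      have b2 := mul_le_mul_of_nonneg_left a2.le (sub_nonneg.2 hx1)
      linarith
  obtain ⟨v, hv⟩ := hv
  -- substitutions
  let θc : Bool → Bool → α → α ⊕ Bool := fun u v q =>
    if q = e then .inr u else if q = e' then .inr v else .inl q
  let θl : α → α ⊕ Bool := fun q => if q = e then .inr d else if q = e' then .inl a else .inl q
  have hθc : ∀ u v q1 q2 r, θc u v q1 = .inl r → θc u v q2 = .inl r → q1 = q2 := by
    intro u v q1 q2 r
    simp only [θc]
    split_ifs <;> simp <;> grind
  have hθl : ∀ q1 q2 r, θl q1 = .inl r → θl q2 = .inl r → q1 = q2 := by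
    intro q1 q2 r
    simp only [θl]
    split_ifs <;> simp <;> grind
  have costc : ∀ u v s, ec (subst (θc u v) (k u)) (update P' a s) (update w' a 0) = A u v := by
    intro u v s
    rw [subst_ec _ (hθc u v)]
    have e1 : pullP (θc u v) (update P' a s) = update (Pe u) e' (dl v) := by
      funext q
      by_cases q1 : q = e
      · subst q1; simp [pullP, θc, hPe, hee]
      · by_cases q2 : q = e'
        · subst q2; simp [pullP, θc, q1]
        · have : q ≠ a := by rcases ha with h | h <;> rw [h] <;> assumption
          simp [pullP, θc, q1, q2, hPe, this, g4 q q1 q2]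
    have e2 : pullW (θc u v) (update w' a 0) = update we e' 0 := by
      funext q
      by_cases q1 : q = e
      · subst q1; simp [pullW, θc, hwe, hee]
      · by_cases q2 : q = e'
        · subst q2; simp [pullW, θc, q1]
        · have : q ≠ a := by rcases ha with h | h <;> rw [h] <;> assumption
          simp [pullW, θc, q1, q2, hwe, this, g5 q q1 q2]
    rw [e1, e2]
  have costl : ec (subst θl (k d)) P' w'
      = x ^ 2 * A d d + (1 - x ^ 2) * A d (!d) + c * (1 + x) * β1 := by
    have l2 := l1 (P' a) (w' a) (by rw [g1, g2]; ring)
    rw [g1, g2, g3] at l2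
    rw [subst_ec _ hθl, ← l2, ← g3]
    have e1 : pullP θl P' = update (Pe d) e' (P' a) := by
      funext q
      by_cases q1 : q = e
      · subst q1; simp [pullP, θl, hPe, hee]
      · by_cases q2 : q = e'
        · subst q2; simp [pullP, θl, q1]
        · simp [pullP, θl, q1, q2, hPe, g4 q q1 q2]
    have e2 : pullW θl w' = update we e' (w' a) := by
      funext q
      by_cases q1 : q = e
      · subst q1; simp [pullW, θl, hwe, hee]
      · by_cases q2 : q = e'
        · subst q2; simp [pullW, θl, q1]
        · simp [pullW, θl, q1, q2, hwe, g5 q q1 q2]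
    rw [e1, e2]
  let kA : Bool → T α := fun u => if u = d then subst (θc d d) (k d) else subst (θc (!d) v) (k (!d))
  have costA : ec (.query a kA) P' w' = c * (1 + x) + (1 - x ^ 2) * A (!d) v + x ^ 2 * A d d := by
    have c1 := costc d d (dl d)
    have c2 := costc (!d) v (dl (!d))
    clear_value A Pe we
    cases d
    · simp only [Bool.not_false] at g1 g2 c1 c2 ⊢
      simp only [ec, kA, g1, g2, g3]
      simp only [if_true, Bool.not_false, reduceCtorEq, if_false] at c1 c2 ⊢
      rw [c1, c2]
    · simp only [Bool.not_true] at g1 g2 c1 c2 ⊢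
      simp only [ec, kA, g1, g2, g3]
      simp only [if_true, Bool.not_true, reduceCtorEq, if_false] at c1 c2 ⊢
      rw [c1, c2]
      ring
  by_cases hAB : ec (.query a kA) P' w' ≤ ec (.query e k) P w
  · refine ⟨_, hAB, fun f' => ?_⟩
    by_cases hf : f' a = d
    · refine ⟨pullF (θc d d) f', ?_, ?_, ?_⟩
      · have : pullF (θc d d) f' e = d := by simp [pullF, θc]
        simp [T.run, kA, hf, subst_run, this]
      · cases d <;> simp [pullF, θc, gate, hf, hee.symm]
      · intro q q1 q2; simp [pullF, θc, q1, q2]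
    · refine ⟨pullF (θc (!d) v) f', ?_, ?_, ?_⟩
      · have : pullF (θc (!d) v) f' e = !d := by simp [pullF, θc]
        simp [T.run, kA, hf, subst_run, this]
      · cases d <;> simp at hf <;> simp [pullF, θc, gate, hf]
      · intro q q1 q2; simp [pullF, θc, q1, q2]
  · refine ⟨subst θl (k d), ?_, fun f' => ?_⟩
    · push Not at hAB
      rw [costl]
      rw [costA] at hAB
      rw [hcost] at hAB ⊢
      rw [T1] at hAB ⊢
      have key := mul_le_mul_of_nonneg_left hv (show (0:ℝ) ≤ (1 - x) * (1 + x) by nlinarith)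
      rcases hx0.eq_or_lt with h0 | h0
      · subst h0; nlinarith
      · by_contra! hcon
        have := mul_lt_mul_of_pos_left hcon h0
        nlinarith
    · refine ⟨pullF θl f', ?_, ?_, ?_⟩
      · have : pullF θl f' e = d := by simp [pullF, θl]
        simp [T.run, subst_run, this]
      · cases d <;> simp [pullF, θl, gate, hee.symm]
      · intro q q1 q2; simp [pullF, θl, q1, q2]

theorem gate_comm (d x y : Bool) : gate d x y = gate d y x := by
  cases d <;> cases x <;> cases y <;> rfl

theorem merge {α : Type} [DecidableEq α] (a b : α) (hab : a ≠ b)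
    (d : Bool) (x c : ℝ) (hx0 : 0 ≤ x) (hx1 : x ≤ 1) (hc : 0 ≤ c) (t : T α) :
    ∀ (P P' : α → Bool → ℝ) (w w' : α → ℝ) (_ : Nn P)
    (_ : P a d = x) (_ : P a (!d) = 1 - x) (_ : P b d = x) (_ : P b (!d) = 1 - x)
    (_ : w a = c) (_ : w b = c)
    (_ : P' a d = x ^ 2) (_ : P' a (!d) = 1 - x ^ 2) (_ : w' a = c * (1 + x))
    (_ : ∀ q, q ≠ a → q ≠ b → P' q = P q) (_ : ∀ q, q ≠ a → q ≠ b → w' q = w q),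
    ∃ t' : T α, ec t' P' w' ≤ ec t P w ∧
      ∀ f' : α → Bool, ∃ f : α → Bool, t'.run f' = t.run f ∧
        gate d (f a) (f b) = f' a ∧ ∀ q, q ≠ a → q ≠ b → f q = f' q := by
  induction t with
  | ans r =>
    intros
    refine ⟨.ans r, le_rfl, fun f' => ⟨update f' b d, rfl, ?_, ?_⟩⟩
    · cases d <;> simp [gate, hab]
    · intro q _ q2; simp [q2]
  | query q k ih =>
    intro P P' w w' hP h1 h2 h3 h4 h5 h6 g1 g2 g3 g4 g5
    by_cases qa : q = a
    · subst qa
      exact merge_core q b q hab (Or.inl rfl) d x c hx0 hx1 hc k P P' w w' hP h1 h2 h3 h4 h5 h6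
        g1 g2 g3 g4 g5
    by_cases qb : q = b
    · subst qb
      obtain ⟨t', ht, hf⟩ := merge_core q a a (Ne.symm hab) (Or.inr rfl) d x c hx0 hx1 hc k P P' w w'
        hP h3 h4 h1 h2 h6 h5 g1 g2 g3 (fun r r1 r2 => g4 r r2 r1) (fun r r1 r2 => g5 r r2 r1)
      refine ⟨t', ht, fun f' => ?_⟩
      obtain ⟨f, e1, e2, e3⟩ := hf f'
      exact ⟨f, e1, by rw [gate_comm]; exact e2, fun r r1 r2 => e3 r r2 r1⟩
    have hne : ∀ {β : Type} (F : α → β) s, update F q s a = F a ∧ update F q s b = F b := by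
      intro β F s
      exact ⟨update_of_ne (Ne.symm qa) _ _, update_of_ne (Ne.symm qb) _ _⟩
    have key : ∀ v, ∃ t' : T α, ec t' (update P' q (dl v)) (update w' q 0)
          ≤ ec (k v) (update P q (dl v)) (update w q 0) ∧
        ∀ f' : α → Bool, ∃ f : α → Bool, t'.run f' = (k v).run f ∧
        gate d (f a) (f b) = f' a ∧ ∀ q, q ≠ a → q ≠ b → f q = f' q := by
      intro v
      refine ih v _ _ _ _ (hP.upd q v) (by simpa only [hne] using h1) (by simpa only [hne] using h2)
        (by simpa only [hne] using h3) (by simpa only [hne] using h4) (by simpa only [hne] using h5)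
        (by simpa only [hne] using h6) (by simpa only [hne] using g1) (by simpa only [hne] using g2)
        (by simpa only [hne] using g3) ?_ ?_
      · intro r r1 r2
        by_cases hr : r = q
        · subst hr; simp
        · simp [hr, g4 r r1 r2]
      · intro r r1 r2
        by_cases hr : r = q
        · subst hr; simp
        · simp [hr, g5 r r1 r2]
    choose k' hk' hf using key
    refine ⟨.query q k', ?_, fun f' => ?_⟩
    · simp only [ec, g4 q qa qb, g5 q qa qb]
      have a1 := mul_le_mul_of_nonneg_left (hk' true) (hP q true)
      have a2 := mul_le_mul_of_nonneg_left (hk' false) (hP q false)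
      linarith
    · obtain ⟨f, e1, e2, e3⟩ := hf (f' q) f'
      refine ⟨f, ?_, e2, e3⟩
      simp only [T.run]
      rw [e1, e3 q qa qb]

theorem merge_all {V : Type} [DecidableEq V] (d : Bool) (x c : ℝ) (hx0 : 0 ≤ x) (hx1 : x ≤ 1)
    (hc : 0 ≤ c) (lf mu : Bool → ℝ) (h1 : lf d = x) (h2 : lf (!d) = 1 - x)
    (g1 : mu d = x ^ 2) (g2 : mu (!d) = 1 - x ^ 2) (t : T (V × Bool)) (X : Finset V) :
    ∃ t' : T (V × Bool),
      ec t' (fun q => if q.1 ∈ X then (if q.2 then dl true else mu) else lf)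
        (fun q => if q.1 ∈ X then (if q.2 then 0 else c * (1 + x)) else c)
        ≤ ec t (fun _ => lf) (fun _ => c) ∧
      ∀ f' : V × Bool → Bool, ∃ f : V × Bool → Bool, t'.run f' = t.run f ∧
        ∀ v, gate d (f (v, false)) (f (v, true)) =
          if v ∈ X then f' (v, false) else gate d (f' (v, false)) (f' (v, true)) := by
  have hvd : ∀ v d : Bool, ¬ v = d → v = !d := by decide
  have lfn : ∀ v, 0 ≤ lf v := by
    intro v
    by_cases hv : v = d
    · rw [hv, h1]; exact hx0
    · rw [hvd v d hv, h2]; linarith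
  have mun : ∀ v, 0 ≤ mu v := by
    intro v
    by_cases hv : v = d
    · rw [hv, g1]; positivity
    · rw [hvd v d hv, g2]; nlinarith
  induction X using Finset.induction_on with
  | empty => exact ⟨t, by simp, fun f' => ⟨f', rfl, by simp⟩⟩
  | insert u X hu ih =>
    obtain ⟨t1, ht1, hf1⟩ := ih
    obtain ⟨t2, ht2, hf2⟩ := merge (u, false) (u, true) (by simp) d x c hx0 hx1 hc t1
      (fun q => if q.1 ∈ X then (if q.2 then dl true else mu) else lf)
      (fun q => if q.1 ∈ insert u X then (if q.2 then dl true else mu) else lf)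
      (fun q => if q.1 ∈ X then (if q.2 then 0 else c * (1 + x)) else c)
      (fun q => if q.1 ∈ insert u X then (if q.2 then 0 else c * (1 + x)) else c)
      (by
        intro q v
        dsimp only
        split_ifs
        · exact dl_nn _ _
        · exact mun v
        · exact lfn v)
      (by simp [hu, h1]) (by simp [hu, h2]) (by simp [hu, h1]) (by simp [hu, h2])
      (by simp [hu]) (by simp [hu]) (by simp [g1]) (by simp [g2]) (by simp)
      (by
        rintro ⟨v, b⟩ q1 q2
        have : v ≠ u := by rintro rfl; cases b <;> [exact q1 rfl; exact q2 rfl]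
        simp [this])
      (by
        rintro ⟨v, b⟩ q1 q2
        have : v ≠ u := by rintro rfl; cases b <;> [exact q1 rfl; exact q2 rfl]
        simp [this])
    refine ⟨t2, ht2.trans ht1, fun f' => ?_⟩
    obtain ⟨f2, r2, a2, b2⟩ := hf2 f'
    obtain ⟨f1, r1, a1⟩ := hf1 f2
    refine ⟨f1, r2.trans r1, fun v => ?_⟩
    rw [a1 v]
    by_cases hv : v = u
    · subst hv
      simp [hu, a2]
    · have e1 := b2 (v, false) (by simp [hv]) (by simp [hv])
      have e2 := b2 (v, true) (by simp [hv]) (by simp [hv])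
      simp [hv, e1, e2]

def bot : ℕ → Bool → Bool
  | 0, g => g
  | n + 1, g => bot n (!g)

theorem aoval_succ (n : ℕ) (g : Bool) (f : (Fin (n + 1) → Bool) → Bool) :
    aoval (n + 1) g f = gate g (aoval n (!g) (fun v => f (Fin.cons false v)))
      (aoval n (!g) (fun v => f (Fin.cons true v))) := by
  simp [aoval, gate]

theorem aoval_snoc (n : ℕ) : ∀ (g : Bool) (f : (Fin (n + 1) → Bool) → Bool),
    aoval (n + 1) g f = aoval n g (fun v => gate (bot n g)
      (f (Fin.snoc (α := fun _ => Bool) v false)) (f (Fin.snoc (α := fun _ => Bool) v true))) := by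
  induction n with
  | zero =>
    intro g f
    rw [aoval_succ]
    simp only [aoval, bot]
    congr 2 <;> funext i <;> fin_cases i <;> rfl
  | succ n ih =>
    intro g f
    rw [aoval_succ, ih, ih, aoval_succ n]
    simp only [bot, Fin.cons_snoc_eq_snoc_cons]

/-- probability that the root of the iid tree (leaf = 0 with prob p) has value g -/
noncomputable def N : ℕ → Bool → ℝ → ℝ
  | 0, g, p => if g then 1 - p else p
  | n + 1, g, p => (1 - N n (!g) p) ^ 2

noncomputable def Cf : ℕ → ℝ → ℝ
  | 0, _ => 1
  | n + 1, u => (1 + √u) * Cf n (1 - √u)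

theorem N_mem (n : ℕ) : ∀ g p, 0 ≤ p → p ≤ 1 → 0 ≤ N n g p ∧ N n g p ≤ 1 := by
  induction n with
  | zero => intro g p h0 h1; cases g <;> simp [N, h0, h1]
  | succ n ih =>
    intro g p h0 h1
    obtain ⟨a, b⟩ := ih (!g) p h0 h1
    simp only [N]
    constructor
    · positivity
    · nlinarith

/-- prob of zero after merging at a gate d -/
noncomputable def mg (d : Bool) (p : ℝ) : ℝ := if d then 1 - (1 - p) ^ 2 else p ^ 2

theorem N_bot (n : ℕ) : ∀ g p, N (n + 1) g p = N n g (mg (bot n g) p) := by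
  induction n with
  | zero => intro g p; cases g <;> simp [N, mg, bot]
  | succ n ih => intro g p; rw [N, ih, N]; simp [bot]

theorem mg_mem (d : Bool) (p : ℝ) (h0 : 0 ≤ p) (h1 : p ≤ 1) : 0 ≤ mg d p ∧ mg d p ≤ 1 := by
  cases d <;> simp only [mg, if_true, if_false, Bool.false_eq_true] <;> constructor <;> nlinarith

theorem Cf_N (n : ℕ) (g : Bool) (p : ℝ) (h0 : 0 ≤ p) (h1 : p ≤ 1) :
    Cf (n + 1) (N (n + 1) g p) = (2 - N n (!g) p) * Cf n (N n (!g) p) := by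
  have := (N_mem n (!g) p h0 h1).2
  rw [Cf, N, Real.sqrt_sq (by linarith)]
  congr 1
  · ring
  · congr 1; ring

theorem Cf_bot (n : ℕ) : ∀ g p, 0 ≤ p → p ≤ 1 → Cf (n + 1) (N (n + 1) g p) =
    (1 + N 0 (bot n g) p) * Cf n (N n g (mg (bot n g) p)) := by
  induction n with
  | zero =>
    intro g p h0 h1
    rw [Cf_N _ _ _ h0 h1]
    cases g <;> simp [N, Cf, bot] <;> ring
  | succ n ih =>
    intro g p h0 h1
    obtain ⟨m0, m1⟩ := mg_mem (bot (n + 1) g) p h0 h1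
    rw [Cf_N _ _ _ h0 h1, ih _ _ h0 h1, Cf_N _ _ _ m0 m1, N_bot]
    simp only [bot]
    ring

noncomputable def lfp (p : ℝ) : Bool → ℝ := fun v => if v then 1 - p else p

theorem lower (n : ℕ) : ∀ (g : Bool) (p c : ℝ), 0 ≤ p → p ≤ 1 → 0 ≤ c →
    ∀ t : T (Fin n → Bool), (∀ f, t.run f = aoval n g f) →
    c * Cf n (N n g p) ≤ ec t (fun _ => lfp p) (fun _ => c) := by
  induction n with
  | zero =>
    intro g p c h0 h1 hc t ht
    cases t with
    | ans b =>
      have a1 := ht (fun _ => true)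
      have a2 := ht (fun _ => false)
      simp [T.run, aoval] at a1 a2
      simp [a1] at a2
    | query q k =>
      have hP : Nn (fun _ : Fin 0 → Bool => lfp p) := by
        intro _ v; cases v <;> simp [lfp, h0, h1]
      have hw : ∀ r, 0 ≤ update (fun _ : Fin 0 → Bool => c) q 0 r := by
        intro r
        rw [Subsingleton.elim r q]; simp
      have b1 := mul_nonneg (hP q true) (ec_nonneg (k true) _ _ (hP.upd q true) hw)
      have b0 := mul_nonneg (hP q false) (ec_nonneg (k false) _ _ (hP.upd q false) hw)
      simp only [ec, Cf]
      linarith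
  | succ n ih =>
    intro g p c h0 h1 hc t ht
    set d := bot n g with hd
    obtain ⟨hx0, hx1⟩ := N_mem 0 d p h0 h1
    rw [Cf_bot _ _ _ h0 h1, ← mul_assoc, ← hd]
    have hx : N 0 d p = if d then 1 - p else p := rfl
    generalize N 0 d p = x at *
    clear_value d
    obtain ⟨m0, m1⟩ := mg_mem d p h0 h1
    let θ : (Fin (n + 1) → Bool) → ((Fin n → Bool) × Bool) ⊕ Bool :=
      fun q => .inl (Fin.init q, q (Fin.last n))
    have hθ : ∀ q1 q2 r, θ q1 = .inl r → θ q2 = .inl r → q1 = q2 := by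
      intro q1 q2 r e1 e2
      have := e1.trans e2.symm
      simp only [θ, Sum.inl.injEq, Prod.mk.injEq] at this
      rw [← Fin.snoc_init_self q1, ← Fin.snoc_init_self q2, this.1, this.2]
    obtain ⟨t1, ht1, hf1⟩ := merge_all d x c hx0 hx1 hc (lfp p) (lfp (mg d p))
      (by cases d <;> simp [lfp, hx]) (by cases d <;> simp [lfp, hx])
      (by cases d <;> simp [lfp, hx, mg]) (by cases d <;> simp [lfp, hx, mg])
      (subst θ t) Finset.univ
    rw [subst_ec θ hθ] at ht1
    let η : ((Fin n → Bool) × Bool) → (Fin n → Bool) ⊕ Bool :=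
      fun q => if q.2 then .inr true else .inl q.1
    have hη : ∀ q1 q2 r, η q1 = .inl r → η q2 = .inl r → q1 = q2 := by
      rintro ⟨v1, b1⟩ ⟨v2, b2⟩ r
      cases b1 <;> cases b2 <;> simp [η]
      intro e1 e2; rw [e1, e2]
    have hl := ih g (mg d p) (c * (1 + x)) m0 m1 (by positivity) (subst η t1) (by
      intro f'
      rw [subst_run]
      obtain ⟨f, e1, e2⟩ := hf1 (pullF η f')
      rw [e1, subst_run, ht, aoval_snoc, ← hd]
      congr 1
      funext v
      have := e2 v
      simp only [Finset.mem_univ, if_true] at this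
      simpa [pullF, θ, η] using this)
    rw [subst_ec η hη] at hl
    have e1 : pullP η (fun _ => lfp (mg d p)) = (fun q => if q.1 ∈ (Finset.univ : Finset (Fin n → Bool))
        then (if q.2 then dl true else lfp (mg d p)) else lfp p) := by
      funext ⟨v, b⟩
      cases b <;> simp [pullP, η]
    have e2 : pullW η (fun _ => c * (1 + x)) = (fun q => if q.1 ∈ (Finset.univ : Finset (Fin n → Bool))
        then (if q.2 then 0 else c * (1 + x)) else c) := by
      funext ⟨v, b⟩
      cases b <;> simp [pullW, η]
    rw [e1, e2] at hl
    exact hl.trans ht1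

def CC (g : ℝ → ℝ) : Prop := ∀ x y z, 0 ≤ x → x < y → y < z → z ≤ 1 →
  (z - y) * g x + (y - x) * g z ≤ (z - x) * g y

theorem CC.line {g : ℝ → ℝ} (h : CC g) {u x : ℝ} (hu : 0 ≤ u) (hux : u < x) :
    ∃ m : ℝ, g u = g x - m * (x - u) ∧ ∀ v, x ≤ v → v ≤ 1 → g v ≤ g x + m * (v - x) := by
  refine ⟨(g x - g u) / (x - u), ?_, ?_⟩
  · have : x - u ≠ 0 := by linarith
    field_simp
    ring
  · intro v hv hv1
    rcases hv.eq_or_lt with rfl | hv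
    · simp
    · have := h u x v hu hux hv hv1
      have hp : 0 < x - u := by linarith
      rw [← sub_le_iff_le_add', div_mul_eq_mul_div, le_div_iff₀ hp]
      nlinarith

theorem CC.refl {g : ℝ → ℝ} (h : CC g) : CC (fun y => g (1 - y)) := by
  intro x y z h0 h1 h2 h3
  have := h (1 - z) (1 - y) (1 - x) (by linarith) (by linarith) (by linarith) (by linarith)
  simp only
  nlinarith

theorem CC.step {g : ℝ → ℝ} (h : CC g) (h0 : ∀ y, 0 ≤ g y) : CC (fun p => (1 + √p) * g (1 - √p)) := by
  intro p1 p p2 h1 h2 h3 h4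
  have q0 : 0 ≤ √p1 := Real.sqrt_nonneg _
  have s1 : √p1 < √p := Real.sqrt_lt_sqrt h1 h2
  have s2 : √p < √p2 := Real.sqrt_lt_sqrt (by linarith) h3
  have s3 : √p2 ≤ 1 := by exact Real.sqrt_le_iff.2 ⟨zero_le_one, by simpa using h4⟩
  have e1 : √p1 ^ 2 = p1 := Real.sq_sqrt h1
  have e : √p ^ 2 = p := Real.sq_sqrt (by linarith)
  have e2 : √p2 ^ 2 = p2 := Real.sq_sqrt (by linarith)
  simp only
  generalize √p1 = a at *
  generalize √p = b at *
  generalize √p2 = c at *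
  subst e1 e e2
  have := h.refl
  -- line with g (1-c), g(1-b)
  obtain ⟨m, hm1, hm2⟩ := h.line (u := 1 - c) (x := 1 - b) (by linarith) (by linarith)
  have ga := hm2 (1 - a) (by linarith) (by linarith)
  -- value of the line at 0 is nonnegative
  have hA : 0 ≤ g (1 - b) - m * (1 - b) := by
    rcases s3.eq_or_lt with hc | hc
    · have := h0 (1 - c)
      rw [hm1] at this
      rw [hc] at this
      nlinarith
    · have k := h 0 (1 - c) (1 - b) le_rfl (by linarith) (by linarith) (by linarith)
      have k0 := h0 0
      rw [hm1] at k
      have k2 := mul_nonneg (show 0 ≤ c - b by linarith) k0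
      by_contra! hcon
      have := mul_pos_of_neg_of_neg (show b - c < 0 by linarith) hcon
      nlinarith
  have gc : g (1 - c) = (g (1 - b) - m * (1 - b)) + m * (1 - c) := by rw [hm1]; ring
  have ga' : g (1 - a) ≤ (g (1 - b) - m * (1 - b)) + m * (1 - a) := by linarith
  have gb : g (1 - b) = (g (1 - b) - m * (1 - b)) + m * (1 - b) := by ring
  generalize g (1 - b) - m * (1 - b) = A at *
  rw [gc, gb]
  have k1 := mul_le_mul_of_nonneg_left ga' (show 0 ≤ (c ^ 2 - b ^ 2) * (1 + a) from
    mul_nonneg (by nlinarith) (by linarith))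
  have k2 := mul_nonneg hA (mul_nonneg (mul_nonneg (show 0 ≤ c - b by linarith)
    (show 0 ≤ b - a by linarith)) (show 0 ≤ c - a by linarith))
  nlinarith

theorem Cf_pos (n : ℕ) : ∀ u, 0 < Cf n u := by
  induction n with
  | zero => intro u; simp [Cf]
  | succ n ih =>
    intro u
    have := ih (1 - √u)
    rw [Cf]
    positivity

theorem Cf_CC (n : ℕ) : CC (Cf n) := by
  induction n with
  | zero => intro x y z _ _ _ _; simp [Cf]
  | succ n ih => exact ih.step (fun y => (Cf_pos n y).le)

theorem ineq_strict {D : ℝ → ℝ} (h : CC D) (h1 : 0 < D 1) {u v x : ℝ} (hu : 0 < u) (huv : u < v)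
    (hv : v ≤ 1) (hx : 0 ≤ x) (hxx : x ^ 2 = u * v) : D u + u * D v < (1 + x) * D x := by
  have hux : u < x := by nlinarith
  have hxv : x < v := by nlinarith
  obtain ⟨m, m1, m2⟩ := h.line hu.le hux
  have a1 := m2 v hxv.le hv
  have a2 := m2 1 (by linarith) le_rfl
  have a3 := mul_le_mul_of_nonneg_left a1 hu.le
  have a4 := mul_pos (show 0 < x - u by linarith) (show 0 < D x + m * (1 - x) by linarith)
  have a5 : u * (D x + m * (v - x)) = u * D x + m * (x ^ 2 - u * x) := by rw [hxx]; ring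
  rw [a5] at a3
  rw [m1]
  nlinarith

theorem ineq {D : ℝ → ℝ} (h : CC D) (h1 : 0 < D 1) {u v x : ℝ} (hu : 0 ≤ u) (huv : u ≤ v)
    (hv : v ≤ 1) (hx : 0 ≤ x) (hxx : x ^ 2 = u * v) : D u + u * D v ≤ (1 + x) * D x := by
  rcases hu.eq_or_lt with rfl | hu
  · have : x = 0 := by nlinarith
    subst this; simp
  · rcases huv.eq_or_lt with rfl | huv
    · have : x = u := by nlinarith
      subst this
      linarith
    · exact (ineq_strict h h1 hu huv hv hx hxx).le

theorem N_inj (n : ℕ) : ∀ g p p', 0 ≤ p → p ≤ 1 → 0 ≤ p' → p' ≤ 1 → N n g p = N n g p' → p = p' := by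
  induction n with
  | zero => intro g p p' _ _ _ _ h; cases g <;> simp [N] at h <;> exact h
  | succ n ih =>
    intro g p p' a b c d h
    obtain ⟨x0, x1⟩ := N_mem n (!g) p a b
    obtain ⟨y0, y1⟩ := N_mem n (!g) p' c d
    apply ih (!g) p p' a b c d
    simp only [N] at h
    have := (sq_eq_sq₀ (by linarith) (by linarith)).1 h
    linarith

theorem N_surj (n : ℕ) : ∀ g u, 0 ≤ u → u ≤ 1 → ∃ p, 0 ≤ p ∧ p ≤ 1 ∧ N n g p = u := by
  induction n with
  | zero =>
    intro g u h0 h1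
    cases g
    · exact ⟨u, h0, h1, by simp [N]⟩
    · exact ⟨1 - u, by linarith, by linarith, by simp [N]⟩
  | succ n ih =>
    intro g u h0 h1
    have s3 : √u ≤ 1 := by exact Real.sqrt_le_iff.2 ⟨zero_le_one, by simpa using h1⟩
    obtain ⟨p, a, b, c⟩ := ih (!g) (1 - √u) (by linarith) (by linarith [Real.sqrt_nonneg u])
    refine ⟨p, a, b, ?_⟩
    rw [N, c]
    simp [Real.sq_sqrt h0]

-- probability part

noncomputable def Ex {n : ℕ} (σ : (Fin n → Bool) → ℝ) (X : ((Fin n → Bool) → Bool) → ℝ) : ℝ :=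
  ∑ f : (Fin n → Bool) → Bool, wt σ f * X f

theorem Ex_add {n : ℕ} (σ : (Fin n → Bool) → ℝ) (X Y : ((Fin n → Bool) → Bool) → ℝ) :
    Ex σ (fun f => X f + Y f) = Ex σ X + Ex σ Y := by
  simp [Ex, mul_add, Finset.sum_add_distrib]

theorem Ex_sub {n : ℕ} (σ : (Fin n → Bool) → ℝ) (X Y : ((Fin n → Bool) → Bool) → ℝ) :
    Ex σ (fun f => X f - Y f) = Ex σ X - Ex σ Y := by
  simp [Ex, mul_sub, Finset.sum_sub_distrib]

theorem Ex_one {n : ℕ} (σ : (Fin n → Bool) → ℝ) : Ex σ (fun _ => 1) = 1 := by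
  simp only [Ex, wt, mul_one]
  have := (Finset.prod_univ_sum (fun _ : Fin n → Bool => (Finset.univ : Finset Bool))
    (fun q b => if b then 1 - σ q else σ q)).symm
  rw [Fintype.piFinset_univ] at this
  rw [this]
  simp

theorem wt_nonneg {n : ℕ} {σ : (Fin n → Bool) → ℝ} (h : validID σ) (f) : 0 ≤ wt σ f := by
  apply Finset.prod_nonneg
  intro q _
  have := h q
  split_ifs <;> linarith

theorem Ex_nonneg {n : ℕ} {σ : (Fin n → Bool) → ℝ} (h : validID σ) {X} (hX : ∀ f, 0 ≤ X f) :
    0 ≤ Ex σ X := Finset.sum_nonneg fun f _ => mul_nonneg (wt_nonneg h f) (hX f)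

theorem wt_erase {n : ℕ} (σ : (Fin n → Bool) → ℝ) (f) (q : Fin n → Bool) :
    wt σ f = (if f q then 1 - σ q else σ q) *
      ∏ r ∈ Finset.univ.erase q, (if f r then 1 - σ r else σ r) :=
  (Finset.mul_prod_erase _ _ (Finset.mem_univ q)).symm

theorem wt_cond {n : ℕ} (σ : (Fin n → Bool) → ℝ) (f) (q : Fin n → Bool) (A B : ℝ) :
    wt σ f * (if f q then A else B) =
      (1 - σ q) * (wt (update σ q 0) f * A) + σ q * (wt (update σ q 1) f * B) := by
  have he : ∀ s, ∏ r ∈ Finset.univ.erase q, (if f r then 1 - update σ q s r else update σ q s r)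
      = ∏ r ∈ Finset.univ.erase q, (if f r then 1 - σ r else σ r) := by
    intro s
    apply Finset.prod_congr rfl
    intro r hr
    rw [update_of_ne (Finset.ne_of_mem_erase hr)]
  rw [wt_erase σ f q, wt_erase (update σ q 0) f q, wt_erase (update σ q 1) f q, he, he]
  cases f q <;> simp <;> ring

def conv {n : ℕ} : DTree n → T (Fin n → Bool)
  | .ans b => .ans b
  | .query q t0 t1 => .query q (fun v => if v then conv t1 else conv t0)

theorem conv_run {n : ℕ} (t : DTree n) (f) : (conv t).run f = t.run f := by
  induction t with
  | ans b => rfl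
  | query q t0 t1 h0 h1 => cases h : f q <;> simp [conv, T.run, DTree.run, h, h0, h1]

theorem eCost_eq {n : ℕ} (t : DTree n) (σ) : eCost t σ = Ex σ (fun f => (t.cost f : ℝ)) := rfl

theorem eCost_query {n : ℕ} (q) (t0 t1 : DTree n) (σ) : eCost (.query q t0 t1) σ =
    1 + (1 - σ q) * eCost t1 (update σ q 0) + σ q * eCost t0 (update σ q 1) := by
  rw [eCost_eq]
  have : (fun f => ((DTree.query q t0 t1).cost f : ℝ)) =
      fun f => 1 + (if f q then (t1.cost f : ℝ) else t0.cost f) := by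
    funext f
    simp only [DTree.cost]
    push_cast
    split_ifs <;> rfl
  rw [this, Ex_add, Ex_one]
  simp only [Ex, wt_cond, Finset.sum_add_distrib, ← Finset.mul_sum, eCost]
  ring

theorem valid_upd {n : ℕ} {σ : (Fin n → Bool) → ℝ} (h : validID σ) (q) (s : ℝ) (h0 : 0 ≤ s)
    (h1 : s ≤ 1) : validID (update σ q s) := by
  intro r
  by_cases hr : r = q
  · subst hr; simp [h0, h1]
  · simpa [hr] using h r

theorem ec_le_eCost {n : ℕ} (t : DTree n) : ∀ (σ : (Fin n → Bool) → ℝ) (w : (Fin n → Bool) → ℝ),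
    validID σ → (∀ q, w q ≤ 1) → ec (conv t) (fun q => lfp (σ q)) w ≤ eCost t σ := by
  induction t with
  | ans b => intro σ w _ _; simp [conv, ec, eCost, DTree.cost]
  | query q t0 t1 h0 h1 =>
    intro σ w hσ hw
    have hw' : ∀ r, update w q 0 r ≤ 1 := by
      intro r
      by_cases hr : r = q
      · subst hr; simp
      · simpa [hr] using hw r
    have e1 : update (fun q => lfp (σ q)) q (dl true) = fun r => lfp (update σ q 0 r) := by
      funext r
      by_cases hr : r = q
      · subst hr; funext v; cases v <;> simp [lfp, dl]
      · simp [hr]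
    have e0 : update (fun q => lfp (σ q)) q (dl false) = fun r => lfp (update σ q 1 r) := by
      funext r
      by_cases hr : r = q
      · subst hr; funext v; cases v <;> simp [lfp, dl]
      · simp [hr]
    rw [eCost_query]
    simp only [conv, ec, e1, e0]
    have a1 := mul_le_mul_of_nonneg_left (h1 (update σ q 0) _
      (valid_upd hσ q 0 le_rfl zero_le_one) hw') (sub_nonneg.2 (hσ q).2)
    have a0 := mul_le_mul_of_nonneg_left (h0 (update σ q 1) _
      (valid_upd hσ q 1 zero_le_one le_rfl) hw') (hσ q).1
    have := hw q
    simp only [lfp, if_true, Bool.false_eq_true, if_false] at a1 a0 ⊢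
    linarith

theorem lower' (n : ℕ) (g : Bool) (p : ℝ) (h0 : 0 ≤ p) (h1 : p ≤ 1) (t : DTree n)
    (ht : t.correct g) : Cf n (N n g p) ≤ eCost t (fun _ => p) := by
  have a := lower n g p 1 h0 h1 zero_le_one (conv t) (fun f => by rw [conv_run]; exact ht f)
  have b := ec_le_eCost t (fun _ => p) (fun _ => 1) (fun _ => ⟨h0, h1⟩) (fun _ => le_rfl)
  linarith

-- splitting

def side {n : ℕ} {β : Type} (b : Bool) (σ : (Fin (n + 1) → Bool) → β) : (Fin n → Bool) → β :=
  fun v => σ (Fin.cons b v)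

def fe (n : ℕ) : ((Fin (n + 1) → Bool) → Bool) ≃
    ((Fin n → Bool) → Bool) × ((Fin n → Bool) → Bool) where
  toFun f := (side false f, side true f)
  invFun p := fun q => if q 0 then p.2 (Fin.tail q) else p.1 (Fin.tail q)
  left_inv f := by
    funext q
    simp only [side]
    rw [← Fin.cons_self_tail q]
    cases h : q 0 <;> simp
  right_inv p := by
    rcases p with ⟨l, r⟩
    apply Prod.ext <;> funext v <;> simp [side]

theorem wt_split {n : ℕ} (σ : (Fin (n + 1) → Bool) → ℝ) (f) :
    wt σ f = wt (side false σ) (side false f) * wt (side true σ) (side true f) := by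
  unfold wt
  rw [← (Fin.consEquiv (fun _ : Fin (n + 1) => Bool)).prod_comp, Fintype.prod_prod_type,
    Fintype.prod_bool, mul_comm]
  rfl

theorem Ex_prod {n : ℕ} (σ : (Fin (n + 1) → Bool) → ℝ) (b : Bool) (X Y) :
    Ex σ (fun f => X (side b f) * Y (side (!b) f)) = Ex (side b σ) X * Ex (side (!b) σ) Y := by
  have key : ∀ X Y, Ex σ (fun f => X (side false f) * Y (side true f))
      = Ex (side false σ) X * Ex (side true σ) Y := by
    intro X Y
    simp only [Ex]
    rw [← (fe n).symm.sum_comp, Fintype.sum_prod_type, Finset.sum_mul_sum]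
    apply Finset.sum_congr rfl; intro l _
    apply Finset.sum_congr rfl; intro r _
    have h := (fe n).apply_symm_apply (l, r)
    have h1 : side false ((fe n).symm (l, r)) = l := congrArg Prod.fst h
    have h2 : side true ((fe n).symm (l, r)) = r := congrArg Prod.snd h
    rw [wt_split, h1, h2]
    ring
  cases b
  · exact key X Y
  · simp only [Bool.not_true]
    rw [mul_comm, ← key]
    congr 1; funext f; ring

noncomputable def nd {n : ℕ} (g : Bool) (σ : (Fin n → Bool) → ℝ) : ℝ :=
  Ex σ (fun f => if aoval n g f = g then 1 else 0)

theorem nd_compl {n : ℕ} (g : Bool) (σ : (Fin n → Bool) → ℝ) :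
    Ex σ (fun f => if aoval n (!g) f = g then 1 else 0) = 1 - nd (!g) σ := by
  rw [nd, ← Ex_one σ, ← Ex_sub]
  congr 1; funext f
  cases g <;> cases aoval n _ f <;> simp [Ex_one]

theorem nd_mem {n : ℕ} (g : Bool) {σ : (Fin n → Bool) → ℝ} (h : validID σ) :
    0 ≤ nd g σ ∧ nd g σ ≤ 1 := by
  constructor
  · apply Ex_nonneg h; intro f; split_ifs <;> norm_num
  · have := nd_compl (!g) σ
    rw [Bool.not_not] at this
    have h2 : 0 ≤ Ex σ (fun f => if aoval n g f = !g then 1 else 0) := by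
      apply Ex_nonneg h; intro f; split_ifs <;> norm_num
    linarith

theorem aoval_side {n : ℕ} (g b : Bool) (f : (Fin (n + 1) → Bool) → Bool) :
    aoval (n + 1) g f = gate g (aoval n (!g) (side b f)) (aoval n (!g) (side (!b) f)) := by
  rw [aoval_succ]
  cases b
  · rfl
  · rw [gate_comm]; rfl

theorem nd_succ {n : ℕ} (g b : Bool) (σ : (Fin (n + 1) → Bool) → ℝ) :
    nd g σ = (1 - nd (!g) (side b σ)) * (1 - nd (!g) (side (!b) σ)) := by
  rw [← nd_compl, ← nd_compl, ← Ex_prod, nd]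
  congr 1; funext f
  rw [aoval_side g b]
  cases g <;> cases aoval n _ (side b f) <;> cases aoval n _ (side (!b) f) <;> simp [gate]

theorem nd_const (n : ℕ) : ∀ (g : Bool) (p : ℝ), nd g (fun _ : Fin n → Bool => p) = N n g p := by
  induction n with
  | zero =>
    intro g p
    have : ∀ X : ((Fin 0 → Bool) → Bool) → ℝ, Ex (fun _ => p) X
        = (1 - p) * X (fun _ => true) + p * X (fun _ => false) := by
      intro X
      simp only [Ex]
      rw [← (Equiv.funUnique (Fin 0 → Bool) Bool).symm.sum_comp, Fintype.sum_bool]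
      simp [wt]
      rfl
    rw [nd, this]
    cases g <;> simp [aoval, N]
  | succ n ih =>
    intro g p
    rw [nd_succ g false, N]
    have : ∀ b, side b (fun _ : Fin (n + 1) → Bool => p) = fun _ => p := fun b => rfl
    rw [this, this, ih]
    ring

theorem rootProb_eq {n : ℕ} (σ : (Fin n → Bool) → ℝ) : rootProb true σ = 1 - nd true σ := by
  rw [nd, ← Ex_one σ, ← Ex_sub, rootProb, Ex]
  apply Finset.sum_congr rfl
  intro f _
  cases aoval n true f <;> simp [Ex_one]

def emb {n : ℕ} (b : Bool) : DTree n → DTree (n + 1)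
  | .ans v => .ans v
  | .query q t0 t1 => .query (Fin.cons b q) (emb b t0) (emb b t1)

def comp {n : ℕ} (b g : Bool) (s : DTree n) : DTree n → DTree (n + 1)
  | .ans v => if v = g then emb (!b) s else .ans (!g)
  | .query q t0 t1 => .query (Fin.cons b q) (comp b g s t0) (comp b g s t1)

theorem emb_run {n : ℕ} (b : Bool) (t : DTree n) (f) : (emb b t).run f = t.run (side b f) := by
  induction t with
  | ans v => rfl
  | query q t0 t1 h0 h1 => simp only [emb, DTree.run, h0, h1]; rfl

theorem emb_cost {n : ℕ} (b : Bool) (t : DTree n) (f) : (emb b t).cost f = t.cost (side b f) := by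
  induction t with
  | ans v => rfl
  | query q t0 t1 h0 h1 => simp only [emb, DTree.cost, h0, h1]; rfl

theorem comp_run {n : ℕ} (b g : Bool) (s t : DTree n) (f) : (comp b g s t).run f =
    if t.run (side b f) = g then s.run (side (!b) f) else !g := by
  induction t with
  | ans v =>
    by_cases h : v = g
    · simp [comp, DTree.run, h, emb_run]
    · simp [comp, DTree.run, h]
  | query q t0 t1 h0 h1 =>
    simp only [comp, DTree.run, h0, h1]
    cases h : f (Fin.cons b q) <;> simp [side, h]

theorem comp_cost {n : ℕ} (b g : Bool) (s t : DTree n) (f) : (comp b g s t).cost f =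
    t.cost (side b f) + if t.run (side b f) = g then s.cost (side (!b) f) else 0 := by
  induction t with
  | ans v =>
    by_cases h : v = g
    · simp [comp, DTree.run, DTree.cost, h, emb_cost]
    · simp [comp, DTree.run, DTree.cost, h]
  | query q t0 t1 h0 h1 =>
    simp only [comp, DTree.run, DTree.cost, h0, h1]
    cases h : f (Fin.cons b q) <;> simp [side, h, add_assoc]

theorem comp_correct {n : ℕ} (b g : Bool) (s t : DTree n) (hs : s.correct (!g))
    (ht : t.correct (!g)) : (comp b g s t).correct g := by
  intro f
  rw [comp_run, aoval_side g b, hs, ht]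
  cases g <;> cases aoval n _ (side b f) <;> simp [gate]

theorem comp_eCost {n : ℕ} (b g : Bool) (s t : DTree n)
    (ht : t.correct (!g)) (σ : (Fin (n + 1) → Bool) → ℝ) : eCost (comp b g s t) σ =
      eCost t (side b σ) + (1 - nd (!g) (side b σ)) * eCost s (side (!b) σ) := by
  rw [eCost_eq, eCost_eq, eCost_eq, ← nd_compl, ← Ex_prod]
  have h1 : Ex (side b σ) (fun f => (t.cost f : ℝ)) =
      Ex σ (fun f => (t.cost (side b f) : ℝ) * 1) := by
    have := Ex_prod σ b (fun f => (t.cost f : ℝ)) (fun _ => 1)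
    rw [Ex_one, mul_one] at this
    exact this.symm
  rw [h1, ← Ex_add]
  congr 1; funext f
  rw [comp_cost, ht]
  push_cast
  split_ifs <;> simp

theorem upper (n : ℕ) : ∀ (g : Bool) (σ : (Fin n → Bool) → ℝ), validID σ →
    ∃ t : DTree n, t.correct g ∧ eCost t σ ≤ Cf n (nd g σ) ∧
      (0 < nd g σ → nd g σ < 1 → (¬ ∃ x : ℝ, ∀ q, σ q = x) → eCost t σ < Cf n (nd g σ)) := by
  induction n with
  | zero =>
    intro g σ hσ
    refine ⟨.query (fun i => i.elim0) (.ans false) (.ans true), ?_, ?_, ?_⟩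
    · intro f
      simp only [DTree.run, aoval]
      cases f _ <;> rfl
    · rw [eCost_query]
      simp [eCost, DTree.cost, Cf]
    · intro _ _ h
      exact absurd ⟨σ (fun i => i.elim0), fun q => congrArg σ (Subsingleton.elim _ _)⟩ h
  | succ n ih =>
    intro g σ hσ
    have hs : ∀ b, validID (side b σ) := fun b q => hσ _
    choose t ht hle hlt using fun b => ih (!g) (side b σ) (hs b)
    have hb : ∃ b, 1 - nd (!g) (side b σ) ≤ 1 - nd (!g) (side (!b) σ) := by
      rcases le_total (1 - nd (!g) (side false σ)) (1 - nd (!g) (side true σ)) with h | h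
      · exact ⟨false, h⟩
      · exact ⟨true, h⟩
    obtain ⟨b, hb⟩ := hb
    refine ⟨comp b g (t (!b)) (t b), comp_correct _ _ _ _ (ht _) (ht _), ?_⟩
    rw [comp_eCost b g _ _ (ht b), nd_succ g b, Cf]
    obtain ⟨m0, m1⟩ := nd_mem (!g) (hs b)
    obtain ⟨m0', m1'⟩ := nd_mem (!g) (hs (!b))
    have l1 := hle b
    have l2 := hle (!b)
    have l3 := hlt b
    have l4 := hlt (!b)
    have hiid : nd (!g) (side b σ) = nd (!g) (side (!b) σ) → (∃ x : ℝ, ∀ q, side b σ q = x) →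
        (∃ x : ℝ, ∀ q, side (!b) σ q = x) → ∃ x : ℝ, ∀ q, σ q = x := by
      rintro he ⟨x, hx⟩ ⟨y, hy⟩
      have ex : side b σ = fun _ => x := funext hx
      have ey : side (!b) σ = fun _ => y := funext hy
      rw [ex, ey, nd_const, nd_const] at he
      have bx := hs b (fun _ => true)
      have bY := hs (!b) (fun _ => true)
      rw [hx] at bx
      rw [hy] at bY
      have := N_inj n (!g) x y bx.1 bx.2 bY.1 bY.2 he
      subst this
      refine ⟨x, fun q => ?_⟩
      rw [← Fin.cons_self_tail q]
      by_cases hq : q 0 = b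
      · rw [hq]; exact hx _
      · rw [show q 0 = !b by revert hq; cases q 0 <;> cases b <;> simp]; exact hy _
    set D : ℝ → ℝ := fun y => Cf n (1 - y) with hD
    have hDC : CC D := (Cf_CC n).refl
    have hD1 : 0 < D 1 := Cf_pos n _
    have eA : Cf n (nd (!g) (side b σ)) = D (1 - nd (!g) (side b σ)) := by simp [hD]
    have eB : Cf n (nd (!g) (side (!b) σ)) = D (1 - nd (!g) (side (!b) σ)) := by simp [hD]
    rw [eA] at l1 l3
    rw [eB] at l2 l4
    generalize eCost (t b) (side b σ) = c1 at *
    generalize eCost (t (!b)) (side (!b) σ) = c2 at *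
    generalize nd (!g) (side b σ) = a at *
    generalize nd (!g) (side (!b) σ) = a' at *
    have hx2 : √((1 - a) * (1 - a')) ^ 2 = (1 - a) * (1 - a') :=
      Real.sq_sqrt (mul_nonneg (by linarith) (by linarith))
    have hx0 := Real.sqrt_nonneg ((1 - a) * (1 - a'))
    generalize √((1 - a) * (1 - a')) = x at *
    change _ ≤ (1 + x) * D x ∧ (_ → _ → _ → _ < (1 + x) * D x)
    have l2' := mul_le_mul_of_nonneg_left l2 (show 0 ≤ 1 - a by linarith)
    have hmain := ineq hDC hD1 (show 0 ≤ 1 - a by linarith) hb (by linarith) hx0 hx2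
    refine ⟨by linarith, fun p0 p1 hni => ?_⟩
    have ha : 0 < 1 - a := by
      rcases (show 0 ≤ 1 - a by linarith).eq_or_lt with h | h
      · rw [← h] at p0; simp at p0
      · exact h
    rcases hb.eq_or_lt with h | h
    · have haa : a = a' := by linarith
      subst haa
      have ha0 : 0 < a := by nlinarith
      by_cases k1 : ∃ x : ℝ, ∀ q, side b σ q = x
      · have k2 : ¬ ∃ x : ℝ, ∀ q, side (!b) σ q = x := fun k2 => hni (hiid rfl k1 k2)
        have := mul_lt_mul_of_pos_left (l4 ha0 (by linarith) k2) ha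
        linarith
      · have := l3 ha0 (by linarith) k1
        linarith
    · have := ineq_strict hDC hD1 ha h (by linarith) hx0 hx2
      linarith

end AOT

/-- Main Theorem: let `T` be the uniform binary AND-OR tree of height
`n ≥ 1` and `0 < r < 1`. If `σ` is an independent distribution on the leaves in which the
root has probability `r` of value 0, and `σ` maximizes the minimum (over deterministic
alpha-beta algorithms) expected cost among all independent distributions with root
probability `r`, then `σ` is an independent identical distribution. -/
theorem eigen_constrained_is_iid (n : ℕ) (hn : 1 ≤ n) (r : ℝ) (hr0 : 0 < r) (hr1 : r < 1)
    (σ : (Fin n → Bool) → ℝ) (hσ : validID σ) (hroot : rootProb true σ = r)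
    (heigen : ∀ σ' : (Fin n → Bool) → ℝ, validID σ' → rootProb true σ' = r →
      minCost true σ' ≤ minCost true σ) :
    ∃ x : ℝ, ∀ q, σ q = x := by
  classical
  by_contra hni
  have hnd : AOT.nd true σ = 1 - r := by
    have := AOT.rootProb_eq σ
    linarith
  obtain ⟨t, ht, -, hlt⟩ := AOT.upper n true σ hσ
  have hlt := hlt (by linarith) (by linarith) hni
  obtain ⟨p, p0, p1, hp⟩ := AOT.N_surj n true (1 - r) (by linarith) (by linarith)
  have hv : validID (fun _ : Fin n → Bool => p) := fun _ => ⟨p0, p1⟩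
  have h1 := heigen (fun _ => p) hv (by rw [AOT.rootProb_eq, AOT.nd_const, hp]; ring)
  have h2 : minCost true σ ≤ eCost t σ := by
    apply csInf_le
    · refine ⟨0, ?_⟩
      rintro c ⟨s, -, rfl⟩
      exact AOT.Ex_nonneg hσ (fun f => Nat.cast_nonneg _)
    · exact ⟨t, ht, rfl⟩
  have h3 : AOT.Cf n (1 - r) ≤ minCost true (fun _ : Fin n → Bool => p) := by
    apply le_csInf
    · exact ⟨_, t, ht, rfl⟩
    · rintro c ⟨s, hs, rfl⟩
      rw [← hp]
      exact AOT.lower' n true p p0 p1 s hs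
  rw [hnd] at hlt
  linarith
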